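/- The value along the first-order attack direction has derivative Υ at zero: lim_{δ→0⁺} (∫ J(x, x + δT(x,y), y) dP(x,y) − ∫ J(x, x, y) dP(x,y))/δ = Υ. In particular, since ⟨∇_{x'}J(x,x,y), T(x,y)⟩ = Υ⁻¹ ‖∇_{x'}J(x,x,y)‖₁² pointwise, the pointwise directional derivatives integrate to Υ. -/

import Mathlib

open MeasureTheory Filter

noncomputable section

/-- The ℓ¹ norm of a vector in ℝⁿ. (The default norm on `Fin n → ℝ` is the ℓ^∞ norm.) -/
def l1norm {n : ℕ} (v : Fin n → ℝ) : ℝ := ∑ i, |v i|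

/-- The continuous linear functional `v ↦ ⟨g, v⟩` on ℝⁿ, representing a gradient. -/
def gradCLM {n : ℕ} (g : Fin n → ℝ) : (Fin n → ℝ) →L[ℝ] ℝ :=
  ∑ i, g i • (ContinuousLinearMap.proj i : (Fin n → ℝ) →L[ℝ] ℝ)

/-- `Pi2 P δ` is the set Π₂(P,δ) of couplings: probability measures π on (ℝⁿ×𝒴)×(ℝⁿ×𝒴)
with first marginal `P`, with `y' = y` π-a.s., and with ∫ ‖x' − x‖_∞² dπ ≤ δ². -/
def Pi2 {n m : ℕ} (P : Measure ((Fin n → ℝ) × Fin m)) (δ : ℝ) :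
    Set (Measure (((Fin n → ℝ) × Fin m) × ((Fin n → ℝ) × Fin m))) :=
  {π | IsProbabilityMeasure π ∧ π.map Prod.fst = P ∧
    (∀ᵐ p ∂π, p.2.2 = p.1.2) ∧ (∫ p, ‖p.2.1 - p.1.1‖ ^ 2 ∂π) ≤ δ ^ 2}

/-- The W-DRO value `V(δ) = sup_{π ∈ Π₂(P,δ)} ∫ J(x,x',y) dπ`. -/
def robustV {n m : ℕ} (P : Measure ((Fin n → ℝ) × Fin m))
    (J : (Fin n → ℝ) → (Fin n → ℝ) → Fin m → ℝ) (δ : ℝ) : ℝ :=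
  ⨆ π : Pi2 P δ, ∫ p, J p.1.1 p.2.1 p.1.2 ∂(π.1)

/-- the value along the first-order attack direction has derivative Υ at zero:
`lim_{δ→0⁺} (∫ J(x, x+δT(x,y), y) dP − ∫ J(x,x,y) dP)/δ = Υ`; moreover
`⟨∇_{x'}J(x,x,y), T(x,y)⟩ = Υ⁻¹‖∇_{x'}J(x,x,y)‖₁²` pointwise and the pointwise directional
derivatives integrate to `Υ`. -/
theorem wdro_value_along_attack_direction
    {n m : ℕ} (hn : 0 < n) (hm : 0 < m)
    (P : Measure ((Fin n → ℝ) × Fin m)) [IsProbabilityMeasure P]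
    (hsupp : P {z | ∀ i, z.1 i ∈ Set.Icc (0 : ℝ) 1} = 1)
    (J : (Fin n → ℝ) → (Fin n → ℝ) → Fin m → ℝ)
    (K : NNReal)
    (hLip : ∀ y, LipschitzWith K (fun p : (Fin n → ℝ) × (Fin n → ℝ) => J p.1 p.2 y))
    (g : (Fin n → ℝ) × Fin m → (Fin n → ℝ))
    (hC1 : ∀ x y, ContDiff ℝ 1 (fun x' => J x x' y))
    (hgrad : ∀ x y, HasFDerivAt (fun x' => J x x' y) (gradCLM (g (x, y))) x)
    (Υ : ℝ) (hΥ : Υ = Real.sqrt (∫ z, (l1norm (g z)) ^ 2 ∂P)) (hΥpos : 0 < Υ)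
    (T : (Fin n → ℝ) × Fin m → (Fin n → ℝ))
    (hT : ∀ z i, T z i = Υ⁻¹ * Real.sign (g z i) * l1norm (g z)) :
    Tendsto
      (fun δ => ((∫ z, J z.1 (z.1 + δ • T z) z.2 ∂P) - ∫ z, J z.1 z.1 z.2 ∂P) / δ)
      (nhdsWithin 0 (Set.Ioi 0)) (nhds Υ) ∧
    (∀ z, ∑ i, g z i * T z i = Υ⁻¹ * (l1norm (g z)) ^ 2) ∧
    (∫ z, ∑ i, g z i * T z i ∂P) = Υ := by
  have hJm : Measurable (fun q : ((Fin n → ℝ) × (Fin n → ℝ)) × Fin m => J q.1.1 q.1.2 q.2) :=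
    measurable_from_prod_countable_left (fun y => (hLip y).continuous.measurable)
  have hJa : ∀ a : (Fin n → ℝ) × Fin m → (Fin n → ℝ), Measurable a →
      Measurable (fun z : (Fin n → ℝ) × Fin m => J z.1 (a z) z.2) := by
    intro a ha
    exact hJm.comp ((measurable_fst.prodMk ha).prodMk measurable_snd)
  have hLip2 : ∀ x y, LipschitzWith K (fun x' => J x x' y) := by
    intro x y
    have h := (hLip y).comp (LipschitzWith.prodMk_left x)
    simpa [Function.comp_def] using h
  have hgv : ∀ (v w : Fin n → ℝ), gradCLM v w = ∑ i, v i * w i := by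
    intro v w
    simp [gradCLM]
  have hdir : ∀ (z : (Fin n → ℝ) × Fin m) (v : Fin n → ℝ),
      Tendsto (fun δ : ℝ => (J z.1 (z.1 + δ • v) z.2 - J z.1 z.1 z.2) / δ)
        (nhdsWithin 0 (Set.Ioi 0)) (nhds (∑ i, g z i * v i)) := by
    intro z v
    have h1 := (hgrad z.1 z.2).hasLineDerivAt v
    have h2 := h1.hasDerivWithinAt (s := Set.Ioi (0:ℝ))
    rw [hasDerivWithinAt_iff_tendsto_slope' (by simp)] at h2
    rw [hgv] at h2
    refine h2.congr ?_
    intro δ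
    simp [slope_def_field]
  have hgm : ∀ i, Measurable (fun z => g z i) := by
    intro i
    have hseq : Tendsto (fun k : ℕ => 1 / ((k : ℝ) + 1)) atTop (nhdsWithin 0 (Set.Ioi 0)) := by
      rw [tendsto_nhdsWithin_iff]
      exact ⟨tendsto_one_div_add_atTop_nhds_zero_nat,
        Eventually.of_forall (fun k => by simp only [Set.mem_Ioi]; positivity)⟩
    refine measurable_of_tendsto_metrizable (f := fun (k : ℕ) (z : (Fin n → ℝ) × Fin m) =>
      (J z.1 (z.1 + (1 / ((k : ℝ) + 1)) • (Pi.single i 1 : Fin n → ℝ)) z.2 - J z.1 z.1 z.2)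
        / (1 / ((k : ℝ) + 1))) ?_ ?_
    · intro k
      exact ((hJa _ (measurable_fst.add_const _)).sub (hJa _ measurable_fst)).div_const _
    · rw [tendsto_pi_nhds]
      intro z
      have := (hdir z (Pi.single i 1)).comp hseq
      simpa [Function.comp_def, Pi.single_apply] using this
  have hlm : Measurable (fun z => l1norm (g z)) := by
    unfold l1norm
    exact Finset.measurable_sum _ (fun i _ => (hgm i).abs)
  have hsm : Measurable Real.sign := by
    unfold Real.sign
    exact Measurable.ite measurableSet_Iio measurable_const
      (Measurable.ite measurableSet_Ioi measurable_const measurable_const)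
  have hTm : Measurable T := by
    rw [measurable_pi_iff]
    intro i
    simp only [hT]
    exact ((hsm.comp (hgm i)).const_mul _).mul hlm
  have hsg : ∀ r : ℝ, r * Real.sign r = |r| := by
    intro r
    rcases lt_trichotomy r 0 with h | h | h
    · rw [Real.sign_of_neg h, abs_of_neg h]; ring
    · simp [h]
    · rw [Real.sign_of_pos h, abs_of_pos h]; ring
  have hsb : ∀ r : ℝ, |Real.sign r| ≤ 1 := by
    intro r
    rcases Real.sign_apply_eq r with h | h | h <;> simp [h]
  have hl0 : ∀ z, 0 ≤ l1norm (g z) := fun z => Finset.sum_nonneg (fun i _ => abs_nonneg _)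
  have hlK : ∀ z, l1norm (g z) ≤ K := by
    intro z
    have h1 : ‖gradCLM (g z)‖ ≤ K := (hgrad z.1 z.2).le_of_lipschitz (hLip2 z.1 z.2)
    have h2 : gradCLM (g z) (fun i => Real.sign (g z i)) = l1norm (g z) := by
      rw [hgv]; simp only [hsg]; rfl
    have h3 : ‖(fun i => Real.sign (g z i) : Fin n → ℝ)‖ ≤ 1 :=
      (pi_norm_le_iff_of_nonneg zero_le_one).2 (fun i => hsb _)
    calc l1norm (g z) ≤ ‖gradCLM (g z) (fun i => Real.sign (g z i))‖ := by
          rw [h2]; exact le_abs_self _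
      _ ≤ K * 1 := (gradCLM (g z)).le_of_opNorm_le_of_le h1 h3
      _ = K := mul_one _
  have hTb : ∀ z, ‖T z‖ ≤ Υ⁻¹ * K := by
    intro z
    refine (pi_norm_le_iff_of_nonneg (by positivity)).2 (fun i => ?_)
    rw [hT, Real.norm_eq_abs, abs_mul, abs_mul, abs_of_pos (inv_pos.2 hΥpos), abs_of_nonneg (hl0 z)]
    calc Υ⁻¹ * |Real.sign (g z i)| * l1norm (g z) ≤ Υ⁻¹ * 1 * K := by
          gcongr
          · exact hl0 z
          · exact hsb _
          · exact hlK z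
      _ = Υ⁻¹ * K := by ring
  have hpt : ∀ z, ∑ i, g z i * T z i = Υ⁻¹ * (l1norm (g z)) ^ 2 := by
    intro z
    have : ∀ i, g z i * T z i = Υ⁻¹ * l1norm (g z) * |g z i| := by
      intro i
      rw [hT, ← hsg]; ring
    simp only [this]
    rw [← Finset.mul_sum]
    change Υ⁻¹ * l1norm (g z) * l1norm (g z) = _
    ring
  have hint : (∫ z, ∑ i, g z i * T z i ∂P) = Υ := by
    simp only [hpt]
    rw [integral_const_mul]
    have h : ∫ z, (l1norm (g z)) ^ 2 ∂P = Υ ^ 2 := by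
      rw [hΥ, Real.sq_sqrt]
      exact integral_nonneg (fun z => sq_nonneg _)
    rw [h]
    field_simp
  refine ⟨?_, hpt, hint⟩
  have hcube : ∀ᵐ z ∂P, ∀ i, z.1 i ∈ Set.Icc (0 : ℝ) 1 := by
    refine (prob_compl_eq_zero_iff ?_).2 hsupp
    simp only [Set.ofPred_forall]
    exact MeasurableSet.iInter fun i =>
      ((measurable_pi_apply i).comp measurable_fst) measurableSet_Icc
  have hI0 : Integrable (fun z => J z.1 z.1 z.2) P := by
    refine Integrable.of_bound (hJa _ measurable_fst).aestronglyMeasurable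
      ((∑ y, |J 0 0 y|) + K) ?_
    filter_upwards [hcube] with z hz
    have h1 := (hLip z.2).dist_le_mul (z.1, z.1) (0, 0)
    have h2 : dist (z.1, z.1) ((0, 0) : (Fin n → ℝ) × (Fin n → ℝ)) ≤ 1 := by
      have : ‖z.1‖ ≤ 1 := (pi_norm_le_iff_of_nonneg zero_le_one).2 (fun i => by
        rw [Real.norm_eq_abs, abs_of_nonneg (hz i).1]; exact (hz i).2)
      simpa [Prod.dist_eq] using this
    have h3 : |J 0 0 z.2| ≤ ∑ y, |J 0 0 y| :=
      Finset.single_le_sum (f := fun y => |J 0 0 y|) (fun y _ => abs_nonneg _) (Finset.mem_univ z.2)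
    have h4 : (K : ℝ) * dist (z.1, z.1) ((0, 0) : (Fin n → ℝ) × (Fin n → ℝ)) ≤ K * 1 := by gcongr
    rw [Real.dist_eq] at h1
    have h5 := abs_sub_abs_le_abs_sub (J z.1 z.1 z.2) (J 0 0 z.2)
    rw [Real.norm_eq_abs]
    simp only at h1
    linarith
  have hdiff : ∀ (δ : ℝ) z, ‖J z.1 (z.1 + δ • T z) z.2 - J z.1 z.1 z.2‖
      ≤ |δ| * (K * (Υ⁻¹ * K)) := by
    intro δ z
    have h1 := (hLip2 z.1 z.2).dist_le_mul (z.1 + δ • T z) z.1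
    rw [dist_eq_norm, dist_eq_norm, add_sub_cancel_left, norm_smul, Real.norm_eq_abs δ] at h1
    calc _ ≤ _ := h1
      _ ≤ K * (|δ| * (Υ⁻¹ * K)) := by gcongr; exact hTb z
      _ = _ := by ring
  have hDm : ∀ δ : ℝ, Measurable (fun z => J z.1 (z.1 + δ • T z) z.2 - J z.1 z.1 z.2) := fun δ =>
    (hJa _ (measurable_fst.add (hTm.const_smul δ))).sub (hJa _ measurable_fst)
  have hI1 : ∀ δ : ℝ, Integrable (fun z => J z.1 (z.1 + δ • T z) z.2) P := by
    intro δ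
    have h : Integrable (fun z => J z.1 (z.1 + δ • T z) z.2 - J z.1 z.1 z.2) P :=
      Integrable.of_bound (hDm δ).aestronglyMeasurable _ (Eventually.of_forall (hdiff δ))
    have h2 := h.add hI0
    refine h2.congr (Eventually.of_forall fun z => ?_)
    simp
  have hmain : Tendsto
      (fun δ : ℝ => ∫ z, (J z.1 (z.1 + δ • T z) z.2 - J z.1 z.1 z.2) / δ ∂P)
      (nhdsWithin 0 (Set.Ioi 0)) (nhds (∫ z, ∑ i, g z i * T z i ∂P)) := by
    refine tendsto_integral_filter_of_dominated_convergence (fun _ => K * (Υ⁻¹ * K)) ?_ ?_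
      (integrable_const _) ?_
    · exact Eventually.of_forall fun δ => ((hDm δ).div_const δ).aestronglyMeasurable
    · filter_upwards [self_mem_nhdsWithin] with δ hδ
      refine Eventually.of_forall fun z => ?_
      have hδ' : (0:ℝ) < |δ| := abs_pos.2 (ne_of_gt hδ)
      rw [norm_div, Real.norm_eq_abs δ, div_le_iff₀ hδ', mul_comm _ |δ|]
      exact hdiff δ z
    · exact Eventually.of_forall fun z => hdir z (T z)
  rw [hint] at hmain
  refine hmain.congr fun δ => ?_
  rw [integral_div, integral_sub (hI1 δ) hI0]
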